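/- For every n ≥ 2, m ∈ ℕ₀, L₀ > 0, E₀ > 0 and ζ > 0 there exists a constant C = C(ζ, n, m, L₀, E₀) > 0 such that: every smooth immersion γ: [-1,1] → ℝⁿ with L(γ) = L₀, 0 < E(γ) ≤ E₀ and L₀ − |γ(1) − γ(−1)| ≥ ζ satisfies |λ(γ)| ≤ C ( 1 + ‖∇E(γ) − λ(γ)κ‖_{L²(ds)} + ‖(∂_s^⊥)^{m+2}κ‖_{L²(ds)}^{1/(m+2)} ), where ‖Φ‖_{L²(ds)} = ( ∫_{-1}^{1} |Φ|² ds )^{1/2}. -/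

import Mathlib

open Set MeasureTheory Filter
open scoped RealInnerProductSpace

noncomputable section

variable {n : ℕ}

/-- Arc-length derivative along the curve `g` of a field `f`. -/
def aderiv {F : Type*} [NormedAddCommGroup F] [NormedSpace ℝ F]
    (g : ℝ → EuclideanSpace ℝ (Fin n)) (f : ℝ → F) : ℝ → F :=
  fun x => ‖deriv g x‖⁻¹ • deriv f x

/-- Unit tangent `∂ₛγ`. -/
def utang (g : ℝ → EuclideanSpace ℝ (Fin n)) : ℝ → EuclideanSpace ℝ (Fin n) :=
  aderiv g g

/-- Normal projection along `g`. -/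
def nperp (g f : ℝ → EuclideanSpace ℝ (Fin n)) : ℝ → EuclideanSpace ℝ (Fin n) :=
  fun x => f x - ⟪f x, utang g x⟫ • utang g x

/-- Curvature vector `κ = ∂ₛ²γ`. -/
def curvV (g : ℝ → EuclideanSpace ℝ (Fin n)) : ℝ → EuclideanSpace ℝ (Fin n) :=
  aderiv g (utang g)

/-- Projected arc-length derivative `∂ₛ^⊥`. -/
def aderivP (g f : ℝ → EuclideanSpace ℝ (Fin n)) : ℝ → EuclideanSpace ℝ (Fin n) :=
  nperp g (aderiv g f)

/-- Iterated projected arc-length derivative `(∂ₛ^⊥)^k`. -/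
def aderivPIter (g : ℝ → EuclideanSpace ℝ (Fin n)) :
    ℕ → (ℝ → EuclideanSpace ℝ (Fin n)) → ℝ → EuclideanSpace ℝ (Fin n)
  | 0, f => f
  | k + 1, f => aderivP g (aderivPIter g k f)

/-- Iterated full arc-length derivative `∂ₛ^k`. -/
def aderivIter (g : ℝ → EuclideanSpace ℝ (Fin n)) :
    ℕ → (ℝ → EuclideanSpace ℝ (Fin n)) → ℝ → EuclideanSpace ℝ (Fin n)
  | 0, f => f
  | k + 1, f => aderiv g (aderivIter g k f)

/-- Elastic energy `E(γ) = ∫ |κ|² ds`. -/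
def elE (g : ℝ → EuclideanSpace ℝ (Fin n)) : ℝ :=
  ∫ x in (-1:ℝ)..1, ‖curvV g x‖ ^ 2 * ‖deriv g x‖

/-- Length `L(γ) = ∫ ds`. -/
def elL (g : ℝ → EuclideanSpace ℝ (Fin n)) : ℝ :=
  ∫ x in (-1:ℝ)..1, ‖deriv g x‖

/-- Energy gradient `∇E(γ) = 2(∂ₛ^⊥)²κ + |κ|²κ`. -/
def gradElE (g : ℝ → EuclideanSpace ℝ (Fin n)) : ℝ → EuclideanSpace ℝ (Fin n) :=
  fun x => (2:ℝ) • aderivPIter g 2 (curvV g) x + ‖curvV g x‖ ^ 2 • curvV g x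

/-- Lagrange multiplier `λ(γ)`. -/
def lagMul (g : ℝ → EuclideanSpace ℝ (Fin n)) : ℝ :=
  (∫ x in (-1:ℝ)..1, ⟪gradElE g x, curvV g x⟫ * ‖deriv g x‖) / elE g

/-- Time derivative `∂ₜγ` of a family. -/
def timeD (γ : ℝ → ℝ → EuclideanSpace ℝ (Fin n)) : ℝ → ℝ → EuclideanSpace ℝ (Fin n) :=
  fun t x => deriv (fun s => γ s x) t

/-- Tangential speed `φ = ⟨∂ₜγ, ∂ₛγ⟩`. -/
def tanSpeed (γ : ℝ → ℝ → EuclideanSpace ℝ (Fin n)) : ℝ → ℝ → ℝ :=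
  fun t x => ⟪timeD γ t x, utang (γ t) x⟫

/-- Normal velocity `V = ∂ₜγ − φ ∂ₛγ`. -/
def normalVel (γ : ℝ → ℝ → EuclideanSpace ℝ (Fin n)) : ℝ → ℝ → EuclideanSpace ℝ (Fin n) :=
  fun t x => timeD γ t x - tanSpeed γ t x • utang (γ t) x

/-- Normal time derivative `∂ₜ^⊥N` of a field along the family γ. -/
def timeDPerp (γ N : ℝ → ℝ → EuclideanSpace ℝ (Fin n)) : ℝ → ℝ → EuclideanSpace ℝ (Fin n) :=
  fun t x => deriv (fun s => N s x) t
    - ⟪deriv (fun s => N s x) t, utang (γ t) x⟫ • utang (γ t) x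

/-- Shape operator `S_p = −Dξ(p)`. -/
def shapeOp (ξ : EuclideanSpace ℝ (Fin n) → EuclideanSpace ℝ (Fin n))
    (p v : EuclideanSpace ℝ (Fin n)) : EuclideanSpace ℝ (Fin n) :=
  -(fderiv ℝ ξ p v)

/-- `L²(ds)` norm of a field along `g`. -/
def l2ds (g f : ℝ → EuclideanSpace ℝ (Fin n)) : ℝ :=
  Real.sqrt (∫ x in (-1:ℝ)..1, ‖f x‖ ^ 2 * ‖deriv g x‖)

/-- Fixed-length free-boundary elastic flow on `[0,T)`. -/
def IsFLFBEF (T : ℝ) (ξ : EuclideanSpace ℝ (Fin n) → EuclideanSpace ℝ (Fin n))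
    (τ : ℝ → ℝ) (γ : ℝ → ℝ → EuclideanSpace ℝ (Fin n)) : Prop :=
  ContDiff ℝ (⊤ : ℕ∞) (fun p : ℝ × ℝ => γ p.1 p.2) ∧
  (∀ t ∈ Ico (0:ℝ) T, ∀ x ∈ Icc (-1:ℝ) 1, deriv (γ t) x ≠ 0) ∧
  (∀ t ∈ Ico (0:ℝ) T, 0 < elE (γ t)) ∧
  (∀ t ∈ Ico (0:ℝ) T, ∀ x ∈ Icc (-1:ℝ) 1,
    timeD γ t x = -(gradElE (γ t) x - lagMul (γ t) • curvV (γ t) x)) ∧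
  (∀ t ∈ Ico (0:ℝ) T, ∀ x ∈ ({-1, 1} : Set ℝ),
    ⟪timeD γ t x, utang (γ t) x⟫ = 0 ∧
    utang (γ t) x = τ x • ξ (γ t x) ∧
    ‖ξ (γ t x)‖ = 1 ∧
    aderivP (γ t) (curvV (γ t)) x = -(τ x • shapeOp ξ (γ t x) (curvV (γ t) x)))



section helpers

variable {E : Type*} [NormedAddCommGroup E] [InnerProductSpace ℝ E]

lemma ii_of_cont {u : ℝ → ℝ} (hu : ContinuousOn u (Icc (-1:ℝ) 1)) :
    IntervalIntegrable u volume (-1) 1 :=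
  hu.intervalIntegrable_of_Icc (by norm_num)

lemma int_nonneg {u : ℝ → ℝ} (h : ∀ x ∈ Icc (-1:ℝ) 1, 0 ≤ u x) :
    0 ≤ ∫ x in (-1:ℝ)..1, u x :=
  intervalIntegral.integral_nonneg (by norm_num) h

lemma wcs {u v w : ℝ → ℝ} (hu : ContinuousOn u (Icc (-1:ℝ) 1))
    (hv : ContinuousOn v (Icc (-1:ℝ) 1)) (hw : ContinuousOn w (Icc (-1:ℝ) 1))
    (hw0 : ∀ x ∈ Icc (-1:ℝ) 1, 0 ≤ w x) :
    (∫ x in (-1:ℝ)..1, u x * v x * w x) ≤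
      Real.sqrt (∫ x in (-1:ℝ)..1, u x ^ 2 * w x) *
      Real.sqrt (∫ x in (-1:ℝ)..1, v x ^ 2 * w x) := by
  have hA : 0 ≤ ∫ x in (-1:ℝ)..1, u x ^ 2 * w x :=
    int_nonneg fun x hx => mul_nonneg (sq_nonneg _) (hw0 x hx)
  have key : ∀ t : ℝ, 0 ≤ (∫ x in (-1:ℝ)..1, u x ^ 2 * w x) * (t * t)
      + (2 * ∫ x in (-1:ℝ)..1, u x * v x * w x) * t + ∫ x in (-1:ℝ)..1, v x ^ 2 * w x := by
    intro t
    have h0 : 0 ≤ ∫ x in (-1:ℝ)..1, (t * u x + v x) ^ 2 * w x :=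
      int_nonneg fun x hx => mul_nonneg (sq_nonneg _) (hw0 x hx)
    have e : (∫ x in (-1:ℝ)..1, (t * u x + v x) ^ 2 * w x) =
        ∫ x in (-1:ℝ)..1, ((t * t) * (u x ^ 2 * w x) + (2 * t) * (u x * v x * w x)
          + v x ^ 2 * w x) := by
      congr 1; ext x; ring
    rw [e, intervalIntegral.integral_add, intervalIntegral.integral_add,
      intervalIntegral.integral_const_mul, intervalIntegral.integral_const_mul] at h0
    · linarith
    all_goals exact ii_of_cont (by fun_prop)
  have hd := discrim_le_zero key
  rw [discrim] at hd
  rw [← Real.sqrt_mul hA]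
  apply Real.le_sqrt_of_sq_le
  nlinarith

lemma sup_est {f g : ℝ → E} {w : ℝ → ℝ} {L : ℝ}
    (hf : ContinuousOn f (Icc (-1:ℝ) 1)) (hg : ContinuousOn g (Icc (-1:ℝ) 1))
    (hw : ContinuousOn w (Icc (-1:ℝ) 1)) (hw0 : ∀ x ∈ Icc (-1:ℝ) 1, 0 ≤ w x)
    (hL : ∫ x in (-1:ℝ)..1, w x = L)
    (hd : ∀ x ∈ Icc (-1:ℝ) 1, HasDerivAt (fun y => ‖f y‖ ^ 2) (2 * (w x * inner ℝ (f x) (g x))) x)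
    {x : ℝ} (hx : x ∈ Icc (-1:ℝ) 1) :
    L * ‖f x‖ ^ 2 ≤ Real.sqrt (∫ x in (-1:ℝ)..1, ‖f x‖ ^ 2 * w x) ^ 2
      + 2 * L * (Real.sqrt (∫ x in (-1:ℝ)..1, ‖f x‖ ^ 2 * w x) *
      Real.sqrt (∫ x in (-1:ℝ)..1, ‖g x‖ ^ 2 * w x)) := by
  set S := ∫ x in (-1:ℝ)..1, ‖f x‖ * ‖g x‖ * w x with hS
  have hSle := wcs hf.norm hg.norm hw hw0
  have hL0 : 0 ≤ L := hL ▸ int_nonneg hw0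
  have hp : 0 ≤ ∫ x in (-1:ℝ)..1, ‖f x‖ ^ 2 * w x :=
    int_nonneg fun x hx => mul_nonneg (sq_nonneg _) (hw0 x hx)
  have step : ∀ y ∈ Icc (-1:ℝ) 1, ‖f x‖ ^ 2 ≤ ‖f y‖ ^ 2 + 2 * S := by
    intro y hy
    have hsub : uIcc y x ⊆ Icc (-1:ℝ) 1 := by
      rw [← uIcc_of_le (by norm_num : (-1:ℝ) ≤ 1)] at hx hy ⊢
      exact uIcc_subset_uIcc hy hx
    have hc : ContinuousOn (fun z => 2 * (w z * inner ℝ (f z) (g z))) (Icc (-1:ℝ) 1) :=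
      continuousOn_const.mul (hw.mul (hf.inner hg))
    have h1 := intervalIntegral.integral_eq_sub_of_hasDerivAt (a := y) (b := x)
      (fun z hz => hd z (hsub hz)) ((hc.mono hsub).intervalIntegrable)
    have hc2 : ContinuousOn (fun z => |2 * (w z * inner ℝ (f z) (g z))|) (Icc (-1:ℝ) 1) := hc.abs
    have h2 : |∫ z in y..x, 2 * (w z * inner ℝ (f z) (g z))| ≤
        ∫ z in (-1:ℝ)..1, |2 * (w z * inner ℝ (f z) (g z))| := by
      refine (intervalIntegral.norm_integral_le_abs_integral_norm
        (f := fun z => 2 * (w z * inner ℝ (f z) (g z)))).trans ?_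
      have h0 : ∀ a b : ℝ, -1 ≤ a → a ≤ b → b ≤ 1 →
          |∫ z in a..b, ‖2 * (w z * inner ℝ (f z) (g z))‖| ≤
          ∫ z in (-1:ℝ)..1, |2 * (w z * inner ℝ (f z) (g z))| := by
        intro a b ha hab hb
        rw [abs_of_nonneg (intervalIntegral.integral_nonneg hab fun _ _ => norm_nonneg _)]
        exact intervalIntegral.integral_mono_interval ha hab hb
          (ae_of_all _ fun z => norm_nonneg (2 * (w z * inner ℝ (f z) (g z)))) (ii_of_cont hc2)
      rcases le_total y x with hyx | hyx
      · exact h0 _ _ hy.1 hyx hx.2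
      · rw [intervalIntegral.integral_symm, abs_neg]
        exact h0 _ _ hx.1 hyx hy.2
    have h3 : (∫ z in (-1:ℝ)..1, |2 * (w z * inner ℝ (f z) (g z))|) ≤ 2 * S := by
      rw [hS, ← intervalIntegral.integral_const_mul]
      apply intervalIntegral.integral_mono_on (by norm_num)
      · exact ii_of_cont hc2
      · exact ii_of_cont (by fun_prop)
      · intro z hz
        rw [abs_mul, abs_mul, abs_two, abs_of_nonneg (hw0 z hz)]
        nlinarith [abs_real_inner_le_norm (f z) (g z), hw0 z hz]
    have := (abs_le.1 (h2.trans h3)).2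
    linarith
  have hI : (∫ y in (-1:ℝ)..1, ‖f x‖ ^ 2 * w y) ≤ ∫ y in (-1:ℝ)..1, (‖f y‖ ^ 2 * w y + 2 * S * w y) := by
    apply intervalIntegral.integral_mono_on (by norm_num)
    · exact ii_of_cont (by fun_prop)
    · exact ii_of_cont (by fun_prop)
    · intro y hy
      nlinarith [step y hy, hw0 y hy]
  rw [intervalIntegral.integral_add (ii_of_cont (by fun_prop)) (ii_of_cont (by fun_prop)),
    intervalIntegral.integral_const_mul, intervalIntegral.integral_const_mul, hL] at hI
  rw [Real.sq_sqrt hp]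
  nlinarith

set_option maxHeartbeats 1000000 in
lemma alg_mult {L : ℝ} (hL : 0 < L) : ∃ Q : ℝ, 0 ≤ Q ∧
    ∀ a0 a1 a2 F G : ℝ, 0 ≤ a0 → 0 ≤ a1 → 0 ≤ a2 →
      L * F ^ 2 ≤ a0 ^ 2 + 2 * L * (a0 * a1) → L * G ^ 2 ≤ a1 ^ 2 + 2 * L * (a1 * a2) →
      a1 ^ 2 ≤ 2 * (F * G) + a0 * a2 → a1 ^ 2 ≤ Q * (a0 ^ 2 + a0 * a2) := by
  set K := 1 / L + 2 with hK
  have hK0 : 0 < K := by positivity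
  set N := 4 * K ^ 2 with hN
  have hN0 : 0 < N := by positivity
  refine ⟨2 * (3 * N + N ^ 2 + 1 + 1), by positivity, ?_⟩
  intro a0 a1 a2 F G h0 h1 h2 hF hG h
  have gen : ∀ x y z : ℝ, 0 ≤ x → 0 ≤ y → L * z ^ 2 ≤ x ^ 2 + 2 * L * (x * y) →
      z ^ 2 ≤ K * (x ^ 2 + x * y) := by
    intro x y z hx hy hz
    have e1 : z ^ 2 ≤ 1 / L * x ^ 2 + 2 * (x * y) := by
      have : z ^ 2 ≤ (x ^ 2 + 2 * L * (x * y)) / L := by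
        rw [le_div_iff₀ hL]; linarith
      calc _ ≤ _ := this
        _ = _ := by field_simp
    have : 0 ≤ 1 / L * (x * y) := by positivity
    rw [hK]
    nlinarith [sq_nonneg x]
  have hF' := gen a0 a1 F h0 h1 hF
  have hG' := gen a1 a2 G h1 h2 hG
  have hFG : 4 * (F ^ 2 * G ^ 2) ≤ N * ((a0 ^ 2 + a0 * a1) * (a1 ^ 2 + a1 * a2)) := by
    have := mul_le_mul hF' hG' (sq_nonneg G) (by positivity)
    rw [hN]; nlinarith
  set P := a0 ^ 2 + a0 * a2 with hP
  have hP0 : 0 ≤ P := by positivity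
  have s1 : a0 ^ 2 * a1 ^ 2 ≤ a1 ^ 2 * P := by
    have : 0 ≤ a1 ^ 2 * (a0 * a2) := by positivity
    rw [hP]; nlinarith
  have s2 : a0 * a1 ^ 2 * a2 ≤ a1 ^ 2 * P := by
    have : 0 ≤ a1 ^ 2 * a0 ^ 2 := by positivity
    rw [hP]; nlinarith
  have s3 : N * (a0 * a1 ^ 3) ≤ a1 ^ 4 / 4 + N ^ 2 * (a0 ^ 2 * a1 ^ 2) := by
    nlinarith [sq_nonneg (a1 ^ 2 / 2 - N * (a0 * a1))]
  have s4 : a0 ^ 2 * a1 * a2 ≤ P ^ 2 / 2 + a1 ^ 2 * P / 2 := by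
    have u1 : (a0 * a2) ^ 2 ≤ P ^ 2 := by
      apply pow_le_pow_left₀ (by positivity)
      rw [hP]; nlinarith [sq_nonneg a0]
    nlinarith [sq_nonneg (a0 * a2 - a0 * a1)]
  have hq1 : 0 ≤ a1 ^ 2 * P := by positivity
  have big : (2 * (F * G)) ^ 2 ≤ (a1 ^ 2 / 2 + (3 * N + N ^ 2 + 1) * P) ^ 2 := by
    have r1 := mul_le_mul_of_nonneg_left s1 hN0.le
    have r2 := mul_le_mul_of_nonneg_left s2 hN0.le
    have r4 := mul_le_mul_of_nonneg_left s4 hN0.le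
    have r1' := mul_le_mul_of_nonneg_left s1 (sq_nonneg N)
    have up : (2 * (F * G)) ^ 2 ≤ a1 ^ 4 / 4 + (3 * N + N ^ 2) * (a1 ^ 2 * P) + N * P ^ 2 := by
      have : 0 ≤ N * (a1 ^ 2 * P) := by positivity
      have : 0 ≤ N * P ^ 2 := by positivity
      have e5 : N * ((a0 ^ 2 + a0 * a1) * (a1 ^ 2 + a1 * a2)) = N * (a0 ^ 2 * a1 ^ 2) + N * (a0 * a1 ^ 3)
        + N * (a0 ^ 2 * a1 * a2) + N * (a0 * a1 ^ 2 * a2) := by ring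
      rw [e5] at hFG
      linarith
    have cc : N ≤ (3 * N + N ^ 2 + 1) ^ 2 := by
      have : 0 ≤ 3 * N + N ^ 2 := by positivity
      have h6 : N ≤ 3 * N + N ^ 2 + 1 := by linarith [sq_nonneg N]
      exact h6.trans (le_self_pow₀ (by linarith) two_ne_zero)
    clear_value P N K
    have := mul_le_mul_of_nonneg_right cc (sq_nonneg P)
    have ex : (a1 ^ 2 / 2 + (3 * N + N ^ 2 + 1) * P) ^ 2 = a1 ^ 4 / 4 +
      (3 * N + N ^ 2) * (a1 ^ 2 * P) + a1 ^ 2 * P + (3 * N + N ^ 2 + 1) ^ 2 * P ^ 2 := by ring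
    rw [ex]
    linarith
  have hh := (abs_le_of_sq_le_sq' big (by positivity)).2
  have : a0 * a2 ≤ P := by rw [hP]; nlinarith [sq_nonneg a0]
  nlinarith

lemma interp (E : Type*) [NormedAddCommGroup E] [InnerProductSpace ℝ E]
    {L : ℝ} (hL0 : 0 < L) : ∃ M : ℝ, 0 ≤ M ∧
    ∀ (f g h : ℝ → E) (w : ℝ → ℝ), 
    ContinuousOn f (Icc (-1:ℝ) 1) → ContinuousOn g (Icc (-1:ℝ) 1) →
    ContinuousOn h (Icc (-1:ℝ) 1) →
    ContinuousOn w (Icc (-1:ℝ) 1) → (∀ x ∈ Icc (-1:ℝ) 1, 0 ≤ w x) →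
    (∫ x in (-1:ℝ)..1, w x = L) →
    (∀ x ∈ Icc (-1:ℝ) 1, HasDerivAt (fun y => ‖f y‖ ^ 2) (2 * (w x * inner ℝ (f x) (g x))) x) →
    (∀ x ∈ Icc (-1:ℝ) 1, HasDerivAt (fun y => ‖g y‖ ^ 2) (2 * (w x * inner ℝ (g x) (h x))) x) →
    (∀ x ∈ Icc (-1:ℝ) 1, HasDerivAt (fun y => inner ℝ (f y) (g y))
      (w x * (‖g x‖ ^ 2 + inner ℝ (f x) (h x))) x) →
    Real.sqrt (∫ x in (-1:ℝ)..1, ‖g x‖ ^ 2 * w x) ^ 2 ≤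
      M * (Real.sqrt (∫ x in (-1:ℝ)..1, ‖f x‖ ^ 2 * w x) ^ 2 +
        Real.sqrt (∫ x in (-1:ℝ)..1, ‖f x‖ ^ 2 * w x) *
        Real.sqrt (∫ x in (-1:ℝ)..1, ‖h x‖ ^ 2 * w x)) := by
  obtain ⟨M, hM, H⟩ := alg_mult hL0
  refine ⟨M, hM, ?_⟩
  intro f g h w hf hg hh hw hw0 hL hdf hdg hdfg
  have m1 : (-1:ℝ) ∈ Icc (-1:ℝ) 1 := by norm_num
  have p1 : (1:ℝ) ∈ Icc (-1:ℝ) 1 := by norm_num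
  have F1 := sup_est hf hg hw hw0 hL hdf m1
  have F2 := sup_est hf hg hw hw0 hL hdf p1
  have G1 := sup_est hg hh hw hw0 hL hdg m1
  have G2 := sup_est hg hh hw hw0 hL hdg p1
  have hq : 0 ≤ ∫ x in (-1:ℝ)..1, ‖g x‖ ^ 2 * w x :=
    int_nonneg fun x hx => mul_nonneg (sq_nonneg _) (hw0 x hx)
  have mF : L * (max ‖f (-1)‖ ‖f 1‖) ^ 2 ≤ Real.sqrt (∫ x in (-1:ℝ)..1, ‖f x‖ ^ 2 * w x) ^ 2
      + 2 * L * (Real.sqrt (∫ x in (-1:ℝ)..1, ‖f x‖ ^ 2 * w x) *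
      Real.sqrt (∫ x in (-1:ℝ)..1, ‖g x‖ ^ 2 * w x)) := by
    rcases max_choice ‖f (-1)‖ ‖f 1‖ with e | e <;> rw [e] <;> assumption
  have mG : L * (max ‖g (-1)‖ ‖g 1‖) ^ 2 ≤ Real.sqrt (∫ x in (-1:ℝ)..1, ‖g x‖ ^ 2 * w x) ^ 2
      + 2 * L * (Real.sqrt (∫ x in (-1:ℝ)..1, ‖g x‖ ^ 2 * w x) *
      Real.sqrt (∫ x in (-1:ℝ)..1, ‖h x‖ ^ 2 * w x)) := by
    rcases max_choice ‖g (-1)‖ ‖g 1‖ with e | e <;> rw [e] <;> assumption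
  refine H _ _ _ _ _ (Real.sqrt_nonneg _) (Real.sqrt_nonneg _) (Real.sqrt_nonneg _) mF mG ?_
  rw [Real.sq_sqrt hq]
  have hcfh : ContinuousOn (fun x => inner ℝ (f x) (h x)) (Icc (-1:ℝ) 1) := hf.inner hh
  have hcin : ContinuousOn (fun x => w x * (‖g x‖ ^ 2 + inner ℝ (f x) (h x))) (Icc (-1:ℝ) 1) := by
    fun_prop
  have e := intervalIntegral.integral_eq_sub_of_hasDerivAt (a := -1) (b := 1)
    (f := fun y => inner ℝ (f y) (g y))
    (f' := fun x => w x * (‖g x‖ ^ 2 + inner ℝ (f x) (h x)))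
    (by rw [uIcc_of_le (by norm_num)]; exact hdfg) (ii_of_cont hcin)
  have e2 : (∫ x in (-1:ℝ)..1, w x * (‖g x‖ ^ 2 + inner ℝ (f x) (h x))) =
      (∫ x in (-1:ℝ)..1, ‖g x‖ ^ 2 * w x) + ∫ x in (-1:ℝ)..1, inner ℝ (f x) (h x) * w x := by
    rw [← intervalIntegral.integral_add (ii_of_cont (by fun_prop)) (ii_of_cont (by fun_prop))]
    congr 1; ext x; ring
  have b0 : -(∫ x in (-1:ℝ)..1, inner ℝ (f x) (h x) * w x) ≤ 
      ∫ x in (-1:ℝ)..1, ‖f x‖ * ‖h x‖ * w x := by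
    rw [← intervalIntegral.integral_neg]
    apply intervalIntegral.integral_mono_on (by norm_num)
    · exact ii_of_cont (by fun_prop)
    · exact ii_of_cont (by fun_prop)
    · intro y hy
      have := (abs_le.1 (abs_real_inner_le_norm (f y) (h y))).1
      nlinarith [hw0 y hy]
  have b1 := wcs hf.norm hh.norm hw hw0
  have c1 : inner ℝ (f 1) (g 1) ≤ max ‖f (-1)‖ ‖f 1‖ * max ‖g (-1)‖ ‖g 1‖ :=
    (real_inner_le_norm _ _).trans (mul_le_mul (le_max_right _ _) (le_max_right _ _)
      (norm_nonneg _) (le_max_of_le_left (norm_nonneg _)))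
  have c2 : -inner ℝ (f (-1)) (g (-1)) ≤ max ‖f (-1)‖ ‖f 1‖ * max ‖g (-1)‖ ‖g 1‖ :=
    (neg_le_abs _).trans <| (abs_real_inner_le_norm _ _).trans
      (mul_le_mul (le_max_left _ _) (le_max_left _ _)
      (norm_nonneg _) (le_max_of_le_left (norm_nonneg _)))
  linarith

lemma discrete (Me : ℝ → ℝ) (hMe : ∀ ε, 0 < ε → 0 ≤ Me ε) (A : ℝ) (hA : 0 ≤ A) (j : ℕ) :
    ∀ ε, 0 < ε → ∃ D : ℝ, 0 ≤ D ∧ ∀ c : ℕ → ℝ, (∀ i, 0 ≤ c i) → c 0 ≤ A →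
      (∀ i, ∀ ε, 0 < ε → c (i+1) ≤ Me ε * c i + ε * c (i+2)) → c j ≤ ε * c (j+1) + D := by
  induction j with
  | zero =>
    intro ε hε
    refine ⟨A, hA, fun c hc h0 _ => ?_⟩
    nlinarith [mul_nonneg hε.le (hc (0+1))]
  | succ j ih =>
    intro ε hε
    have hM := hMe (ε / 2) (by positivity)
    obtain ⟨D, hD, H⟩ := ih (1 / (2 * (Me (ε/2) + 1))) (by positivity)
    refine ⟨2 * (Me (ε/2) * D), by positivity, fun c hc h0 hi => ?_⟩
    have a := H c hc h0 hi
    have b := hi j (ε/2) (by positivity)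
    have d := mul_le_mul_of_nonneg_left a hM
    have e : Me (ε/2) * (1 / (2 * (Me (ε/2) + 1)) * c (j+1)) ≤ 1/2 * c (j+1) := by
      rw [← mul_assoc]
      apply mul_le_mul_of_nonneg_right _ (hc _)
      rw [mul_one_div, div_le_iff₀ (by positivity)]
      linarith
    rw [mul_add] at d
    show c (j+1) ≤ ε * c (j+2) + _
    linarith

lemma discrete' (Me : ℝ → ℝ) (hMe : ∀ ε, 0 < ε → 0 ≤ Me ε) (A : ℝ) (hA : 0 ≤ A) (k : ℕ) :
    ∃ D : ℝ, 0 ≤ D ∧ ∀ c : ℕ → ℝ, (∀ i, 0 ≤ c i) → c 0 ≤ A →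
      (∀ i, ∀ ε, 0 < ε → c (i+1) ≤ Me ε * c i + ε * c (i+2)) → c 1 ≤ c (k+1) + D := by
  induction k with
  | zero => exact ⟨0, le_rfl, fun c _ _ _ => by simp⟩
  | succ k ih =>
    obtain ⟨D, hD, H⟩ := ih
    obtain ⟨D2, hD2, H2⟩ := discrete Me hMe A hA (k+1) 1 one_pos
    refine ⟨D + D2, by positivity, fun c h1 h2 h3 => ?_⟩
    have := H c h1 h2 h3
    have := H2 c h1 h2 h3
    linarith

lemma discrete'' (Q : ℝ) (hQ : 0 ≤ Q) (A : ℝ) (hA : 0 ≤ A) (m : ℕ) :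
    ∃ D : ℝ, 0 ≤ D ∧ ∀ a : ℕ → ℝ, (∀ i, 0 ≤ a i) → a 0 ≤ A →
      (∀ i, a (i+1) ^ 2 ≤ Q * (a i ^ 2 + a i * a (i+2))) →
      a 1 ≤ D * (1 + a (m+2) ^ ((1:ℝ) / (m + 2))) := by
  obtain ⟨D, hD, H⟩ := discrete' (fun ε => Real.sqrt (Q + Q ^ 2 / (4 * ε ^ 2)))
    (fun _ _ => Real.sqrt_nonneg _) A hA (m+1)
  refine ⟨1 + D, by positivity, fun a ha h0 hi => ?_⟩
  set p : ℝ := a (m+2) ^ ((1:ℝ) / (m + 2)) with hp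
  have hp0 : 0 ≤ p := Real.rpow_nonneg (ha _) _
  have hpk : a (m+2) = p ^ (m+2) := by
    rw [hp, ← Real.rpow_natCast, ← Real.rpow_mul (ha _)]
    push_cast
    rw [one_div, inv_mul_cancel₀ (by positivity), Real.rpow_one]
  set T := 1 + p with hT
  have hT0 : 0 < T := by positivity
  have hT1 : 1 ≤ T := by linarith
  have hc : ∀ i, 0 ≤ a i / T ^ i := fun i => div_nonneg (ha i) (by positivity)
  have := H (fun i => a i / T ^ i) hc (by simpa using h0) ?_
  · have hk : a (m+2) / T ^ (m+2) ≤ 1 := by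
      rw [div_le_one (by positivity), hpk]
      exact pow_le_pow_left₀ hp0 (by linarith) _
    have h1 : a 1 / T ^ 1 ≤ 1 + D := by
      refine this.trans ?_
      show a (m+2) / T ^ (m+2) + D ≤ _
      linarith
    rw [pow_one, div_le_iff₀ hT0] at h1
    exact h1
  · intro i ε hε
    show a (i+1) / T ^ (i+1) ≤ Real.sqrt (Q + Q ^ 2 / (4 * ε ^ 2)) * (a i / T ^ i)
      + ε * (a (i+2) / T ^ (i+2))
    have c0 := hc i
    have c2 := hc (i+2)
    have e0 : a i = (a i / T ^ i) * T ^ i := by field_simp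
    have e1 : a (i+1) = (a (i+1) / T ^ (i+1)) * T ^ (i+1) := by field_simp
    have e2 : a (i+2) = (a (i+2) / T ^ (i+2)) * T ^ (i+2) := by field_simp
    have hh := hi i
    rw [e0, e1, e2] at hh
    set u := a i / T ^ i
    set v := a (i+1) / T ^ (i+1)
    set z := a (i+2) / T ^ (i+2)
    have hq : v ^ 2 ≤ Q * (u ^ 2 + u * z) := by
      have hTT : 0 < (T ^ (i+1)) ^ 2 := by positivity
      refine le_of_mul_le_mul_right ?_ hTT
      calc v ^ 2 * (T ^ (i+1)) ^ 2 = (v * T ^ (i+1)) ^ 2 := by ring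
        _ ≤ _ := hh
        _ = Q * (u ^ 2 * (T ^ i) ^ 2 + u * z * (T ^ (i+1)) ^ 2) := by ring
        _ ≤ Q * (u ^ 2 * (T ^ (i+1)) ^ 2 + u * z * (T ^ (i+1)) ^ 2) := by
          gcongr
          omega
        _ = _ := by ring
    have y : Q * (u * z) ≤ Q ^ 2 / (4 * ε ^ 2) * u ^ 2 + ε ^ 2 * z ^ 2 := by
      have e3 : Q ^ 2 / (4 * ε ^ 2) * u ^ 2 + ε ^ 2 * z ^ 2 - Q * (u * z) =
          (Q / (2 * ε) * u - ε * z) ^ 2 := by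
        field_simp; ring
      linarith [sq_nonneg (Q / (2 * ε) * u - ε * z)]
    have hs : Real.sqrt (Q + Q ^ 2 / (4 * ε ^ 2)) ^ 2 = Q + Q ^ 2 / (4 * ε ^ 2) :=
      Real.sq_sqrt (by positivity)
    have hrs := Real.sqrt_nonneg (Q + Q ^ 2 / (4 * ε ^ 2))
    set r := Real.sqrt (Q + Q ^ 2 / (4 * ε ^ 2))
    refine (abs_le_of_sq_le_sq' ?_ (by positivity)).2
    have : 0 ≤ r * u * (ε * z) := by positivity
    calc v ^ 2 ≤ (Q + Q ^ 2 / (4 * ε ^ 2)) * u ^ 2 + ε ^ 2 * z ^ 2 := by linarith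
      _ = r ^ 2 * u ^ 2 + ε ^ 2 * z ^ 2 := by rw [hs]
      _ ≤ _ := by nlinarith

end helpers

section geom

variable {g : ℝ → EuclideanSpace ℝ (Fin n)} 

/-- regular set -/
def regSet (g : ℝ → EuclideanSpace ℝ (Fin n)) : Set ℝ := {x | deriv g x ≠ 0}

lemma contDeriv (hg : ContDiff ℝ (⊤ : ℕ∞) g) : Continuous (deriv g) :=
  hg.continuous_deriv (by simp)

lemma isOpen_regSet (hg : ContDiff ℝ (⊤ : ℕ∞) g) : IsOpen (regSet g) :=
  isOpen_ne_fun (contDeriv hg) continuous_const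

lemma smooth_deriv (hg : ContDiff ℝ (⊤ : ℕ∞) g) {F : Type*} [NormedAddCommGroup F] [NormedSpace ℝ F]
    {f : ℝ → F} (hf : ContDiffOn ℝ (⊤ : ℕ∞) f (regSet g)) :
    ContDiffOn ℝ (⊤ : ℕ∞) (deriv f) (regSet g) :=
  hf.deriv_of_isOpen (isOpen_regSet hg) (by simp)

lemma smooth_aderiv (hg : ContDiff ℝ (⊤ : ℕ∞) g)
    {f : ℝ → EuclideanSpace ℝ (Fin n)} (hf : ContDiffOn ℝ (⊤ : ℕ∞) f (regSet g)) :
    ContDiffOn ℝ (⊤ : ℕ∞) (aderiv g f) (regSet g) := by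
  have h1 := (smooth_deriv hg hg.contDiffOn).norm ℝ (fun x hx => hx)
  exact (h1.inv (fun x hx => norm_ne_zero_iff.2 hx)).smul (smooth_deriv hg hf)

lemma smooth_utang (hg : ContDiff ℝ (⊤ : ℕ∞) g) : ContDiffOn ℝ (⊤ : ℕ∞) (utang g) (regSet g) :=
  smooth_aderiv hg hg.contDiffOn

lemma smooth_curvV (hg : ContDiff ℝ (⊤ : ℕ∞) g) : ContDiffOn ℝ (⊤ : ℕ∞) (curvV g) (regSet g) :=
  smooth_aderiv hg (smooth_utang hg)

lemma smooth_aderivP (hg : ContDiff ℝ (⊤ : ℕ∞) g)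
    {f : ℝ → EuclideanSpace ℝ (Fin n)} (hf : ContDiffOn ℝ (⊤ : ℕ∞) f (regSet g)) :
    ContDiffOn ℝ (⊤ : ℕ∞) (aderivP g f) (regSet g) := by
  have h1 := smooth_aderiv hg hf
  exact h1.sub ((h1.inner ℝ (smooth_utang hg)).smul (smooth_utang hg))

lemma smooth_iter (hg : ContDiff ℝ (⊤ : ℕ∞) g) (j : ℕ) :
    ContDiffOn ℝ (⊤ : ℕ∞) (aderivPIter g j (curvV g)) (regSet g) := by
  induction j with
  | zero => exact smooth_curvV hg
  | succ j ih => exact smooth_aderivP hg ih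

lemma hasDeriv_of_smooth (hg : ContDiff ℝ (⊤ : ℕ∞) g) 
    {f : ℝ → EuclideanSpace ℝ (Fin n)} (hf : ContDiffOn ℝ (⊤ : ℕ∞) f (regSet g)) {x : ℝ}
    (hx : x ∈ regSet g) : HasDerivAt f (‖deriv g x‖ • aderiv g f x) x := by
  have h1 : ‖deriv g x‖ • aderiv g f x = deriv f x := by
    have : ‖deriv g x‖ ≠ 0 := norm_ne_zero_iff.2 hx
    simp only [aderiv]
    rw [smul_inv_smul₀ this]
  rw [h1]
  exact ((hf.contDiffAt ((isOpen_regSet hg).mem_nhds hx)).differentiableAt (by simp)).hasDerivAt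

lemma utang_unit {x : ℝ} (hx : x ∈ regSet g) : inner ℝ (utang g x) (utang g x) = 1 := by
  have : ‖deriv g x‖ ≠ 0 := norm_ne_zero_iff.2 hx
  rw [real_inner_self_eq_norm_sq]
  simp only [utang, aderiv, norm_smul, norm_inv, norm_norm]
  rw [inv_mul_cancel₀ this, one_pow]

lemma curv_normal (hg : ContDiff ℝ (⊤ : ℕ∞) g) {x : ℝ} (hx : x ∈ regSet g) :
    inner ℝ (curvV g x) (utang g x) = 0 := by
  have hT := hasDeriv_of_smooth hg (smooth_utang hg) hx
  have h1 := hT.inner ℝ hT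
  have h2 : HasDerivAt (fun t => inner ℝ (utang g t) (utang g t)) 0 x := by
    refine (hasDerivAt_const x (1:ℝ)).congr_of_eventuallyEq ?_
    filter_upwards [(isOpen_regSet hg).mem_nhds hx] with y hy using utang_unit hy
  have h3 := h1.unique h2
  have : ‖deriv g x‖ ≠ 0 := norm_ne_zero_iff.2 hx
  rw [real_inner_comm, inner_smul_left] at h3
  simp only [conj_trivial] at h3
  have h4 : ‖deriv g x‖ * inner ℝ (aderiv g (utang g) x) (utang g x) = 0 := by linarith
  exact (mul_eq_zero.1 h4).resolve_left this

lemma perp_normal {f : ℝ → EuclideanSpace ℝ (Fin n)} {x : ℝ} (hx : x ∈ regSet g) :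
    inner ℝ (aderivP g f x) (utang g x) = 0 := by
  simp only [aderivP, nperp, inner_sub_left, inner_smul_left, utang_unit hx, conj_trivial]
  ring

lemma iter_normal (hg : ContDiff ℝ (⊤ : ℕ∞) g) (j : ℕ) {x : ℝ} (hx : x ∈ regSet g) :
    inner ℝ (aderivPIter g j (curvV g) x) (utang g x) = 0 := by
  cases j with
  | zero => exact curv_normal hg hx
  | succ j => exact perp_normal hx

lemma aderiv_eq (f : ℝ → EuclideanSpace ℝ (Fin n)) (x : ℝ) :
    aderiv g f x = aderivP g f x + inner ℝ (aderiv g f x) (utang g x) • utang g x := by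
  simp [aderivP, nperp]

lemma inner_aderiv {f : ℝ → EuclideanSpace ℝ (Fin n)} {x : ℝ} {v : EuclideanSpace ℝ (Fin n)}
    (hv : inner ℝ v (utang g x) = 0) :
    inner ℝ v (aderiv g f x) = inner ℝ v (aderivP g f x) := by
  rw [aderiv_eq, inner_add_right, inner_smul_right, hv]; ring

lemma aderiv_tang (hg : ContDiff ℝ (⊤ : ℕ∞) g) (j : ℕ) {x : ℝ} (hx : x ∈ regSet g) :
    inner ℝ (aderiv g (aderivPIter g j (curvV g)) x) (utang g x)
      = - inner ℝ (aderivPIter g j (curvV g) x) (curvV g x) := by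
  have hT := hasDeriv_of_smooth hg (smooth_utang hg) hx
  have hK := hasDeriv_of_smooth hg (smooth_iter hg j) hx
  have h1 := hK.inner ℝ hT
  have h2 : HasDerivAt (fun t => inner ℝ (aderivPIter g j (curvV g) t) (utang g t)) 0 x := by
    refine (hasDerivAt_const x (0:ℝ)).congr_of_eventuallyEq ?_
    filter_upwards [(isOpen_regSet hg).mem_nhds hx] with y hy using iter_normal hg j hy
  have h3 := h1.unique h2
  have : ‖deriv g x‖ ≠ 0 := norm_ne_zero_iff.2 hx
  rw [inner_smul_left, inner_smul_right] at h3
  simp only [conj_trivial] at h3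
  rw [← mul_add] at h3
  have h4 := (mul_eq_zero.1 h3).resolve_left this
  change inner ℝ (aderivPIter g j (curvV g) x) (curvV g x) + _ = 0 at h4
  linarith

lemma l2_interp {L : ℝ} (hL : 0 < L) : ∃ Q : ℝ, 0 ≤ Q ∧
    ∀ g : ℝ → EuclideanSpace ℝ (Fin n), ContDiff ℝ (⊤ : ℕ∞) g →
    (∀ x ∈ Icc (-1:ℝ) 1, deriv g x ≠ 0) → elL g = L → ∀ i : ℕ,
    l2ds g (aderivPIter g (i+1) (curvV g)) ^ 2 ≤ Q * (l2ds g (aderivPIter g i (curvV g)) ^ 2 +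
      l2ds g (aderivPIter g i (curvV g)) * l2ds g (aderivPIter g (i+2) (curvV g))) := by
  obtain ⟨Q, hQ, H⟩ := interp (EuclideanSpace ℝ (Fin n)) hL
  refine ⟨Q, hQ, fun g hg hr hLg i => ?_⟩
  have hc : ∀ j, ContinuousOn (aderivPIter g j (curvV g)) (Icc (-1:ℝ) 1) :=
    fun j => (smooth_iter hg j).continuousOn.mono hr
  have hn : ∀ j, ∀ x ∈ Icc (-1:ℝ) 1, HasDerivAt (fun y => ‖aderivPIter g j (curvV g) y‖ ^ 2)
      (2 * (‖deriv g x‖ * inner ℝ (aderivPIter g j (curvV g) x) (aderivPIter g (j+1) (curvV g) x))) x := by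
    intro j x hx
    have := (hasDeriv_of_smooth hg (smooth_iter hg j) (hr x hx)).norm_sq
    rw [inner_smul_right, inner_aderiv (iter_normal hg j (hr x hx))] at this
    exact this
  refine H _ _ _ (fun x => ‖deriv g x‖) (hc i) (hc (i+1)) (hc (i+2)) (contDeriv hg).norm.continuousOn
    (fun _ _ => norm_nonneg _) hLg (hn i) (hn (i+1)) ?_
  intro x hx
  have := (hasDeriv_of_smooth hg (smooth_iter hg i) (hr x hx)).inner ℝ
    (hasDeriv_of_smooth hg (smooth_iter hg (i+1)) (hr x hx))
  rw [inner_smul_right, inner_aderiv (iter_normal hg i (hr x hx)),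
    real_inner_comm (aderivPIter g (i+1) (curvV g) x) (‖deriv g x‖ • _), inner_smul_right,
    inner_aderiv (iter_normal hg (i+1) (hr x hx))] at this
  refine HasDerivAt.congr_deriv this ?_
  symm
  rw [← real_inner_self_eq_norm_sq]
  show _ = _ * inner ℝ (aderivPIter g i (curvV g) x) (aderivPIter g (i+2) (curvV g) x) + _ *
    inner ℝ (aderivPIter g (i+1) (curvV g) x) (aderivPIter g (i+1) (curvV g) x)
  ring

/-- the conserved vector field -/
def pvec (g : ℝ → EuclideanSpace ℝ (Fin n)) (l : ℝ) : ℝ → EuclideanSpace ℝ (Fin n) :=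
  fun x => (2:ℝ) • aderivPIter g 1 (curvV g) x + (‖curvV g x‖ ^ 2 - l) • utang g x

lemma pvec_deriv (hg : ContDiff ℝ (⊤ : ℕ∞) g) (l : ℝ) {x : ℝ} (hx : x ∈ regSet g) :
    HasDerivAt (pvec g l) (‖deriv g x‖ • (gradElE g x - l • curvV g x)) x := by
  have hT := hasDeriv_of_smooth hg (smooth_utang hg) hx
  have hK := hasDeriv_of_smooth hg (smooth_curvV hg) hx
  have hK1 := hasDeriv_of_smooth hg (smooth_iter hg 1) hx
  have hk2 := (hK.norm_sq).sub_const l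
  rw [inner_smul_right, inner_aderiv (curv_normal hg hx)] at hk2
  have := (hK1.const_smul (2:ℝ)).add (hk2.smul hT)
  rw [aderiv_eq, aderiv_tang hg 1 hx] at this
  refine this.congr_deriv ?_
  change (2:ℝ) • ‖deriv g x‖ • (aderivPIter g 2 (curvV g) x + (-inner ℝ (aderivPIter g 1 (curvV g) x) (curvV g x)) • utang g x)
    + ((‖curvV g x‖ ^ 2 - l) • ‖deriv g x‖ • curvV g x +
     (2 * (‖deriv g x‖ * inner ℝ (curvV g x) (aderivPIter g 1 (curvV g) x))) • utang g x) = _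
  rw [real_inner_comm (aderivPIter g 1 (curvV g) x), gradElE]
  module

end geom

section mainest

variable {g : ℝ → EuclideanSpace ℝ (Fin n)} 

lemma pvec_inner {x : ℝ} (hg : ContDiff ℝ (⊤ : ℕ∞) g) (hx : x ∈ regSet g) (l L : ℝ)
    (d : EuclideanSpace ℝ (Fin n)) :
    inner ℝ (pvec g l x) (‖deriv g x‖ • (utang g x - L⁻¹ • d)) =
      ‖curvV g x‖ ^ 2 * ‖deriv g x‖ - l * ‖deriv g x‖ + l * L⁻¹ * inner ℝ (deriv g x) d
      - L⁻¹ * (2 * inner ℝ (aderivPIter g 1 (curvV g) x) d +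
        ‖curvV g x‖ ^ 2 * inner ℝ (utang g x) d) * ‖deriv g x‖ := by
  have hw : ‖deriv g x‖ ≠ 0 := norm_ne_zero_iff.2 hx
  have e : deriv g x = ‖deriv g x‖ • utang g x := by
    simp only [utang, aderiv]; rw [smul_inv_smul₀ hw]
  have e' : inner ℝ (deriv g x) d = ‖deriv g x‖ * inner ℝ (utang g x) d := by
    conv_lhs => rw [e]
    rw [inner_smul_left]; simp
  rw [e']
  simp only [pvec, inner_smul_right, inner_sub_right, inner_add_left, inner_smul_left,
    iter_normal hg 1 hx, utang_unit hx, conj_trivial]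
  ring

lemma main_est (hg : ContDiff ℝ (⊤ : ℕ∞) g) (hr : ∀ x ∈ Icc (-1:ℝ) 1, deriv g x ≠ 0)
    {L ζ : ℝ} (hL0 : 0 < L) (hL : elL g = L) (hζ : 0 < ζ) (hd : ζ ≤ L - ‖g 1 - g (-1)‖) (l : ℝ) :
    |l| * ζ ≤ Real.sqrt ((2 * L) ^ 2 * L) * l2ds g (fun x => gradElE g x - l • curvV g x)
      + 2 * elE g + 2 * Real.sqrt L * l2ds g (aderivPIter g 1 (curvV g)) := by
  set d := g 1 - g (-1) with hdd
  have hdL : ‖d‖ ≤ L := by linarith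
  have hdL' : L⁻¹ * ‖d‖ ≤ 1 := by
    rw [inv_mul_le_iff₀ hL0]; linarith
  have hwc : Continuous (fun x => ‖deriv g x‖) := (contDeriv hg).norm
  have hwco := hwc.continuousOn (s := Icc (-1:ℝ) 1)
  set V := (fun x => gradElE g x - l • curvV g x) with hV
  set σ : ℝ → ℝ := fun x => ∫ y in (-1:ℝ)..x, ‖deriv g y‖ with hσ
  have hσd : ∀ x, HasDerivAt σ ‖deriv g x‖ x := fun x => hwc.integral_hasStrictDerivAt _ _ |>.hasDerivAt
  have hσ0 : σ (-1) = 0 := by simp [hσ]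
  have hσ1 : σ 1 = L := hL
  set X : ℝ → EuclideanSpace ℝ (Fin n) := fun x => (g x - g (-1)) - σ x • (L⁻¹ • d) with hX
  have hXd : ∀ x ∈ Icc (-1:ℝ) 1, HasDerivAt X (‖deriv g x‖ • (utang g x - L⁻¹ • d)) x := by
    intro x hx
    have h1 := (hasDeriv_of_smooth hg hg.contDiffOn (hr x hx)).sub_const (g (-1))
    have h2 := (hσd x).smul_const (L⁻¹ • d)
    have := h1.sub h2
    rw [← smul_sub] at this
    exact this
  have hX0 : X (-1) = 0 := by simp [hX, hσ0]
  have hX1 : X 1 = 0 := by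
    simp only [hX, hσ1]; rw [smul_inv_smul₀ hL0.ne', ← hdd, sub_self]
  have hσle : ∀ x ∈ Icc (-1:ℝ) 1, 0 ≤ σ x ∧ σ x ≤ L := by
    intro x hx
    refine ⟨intervalIntegral.integral_nonneg hx.1 fun _ _ => norm_nonneg _, ?_⟩
    rw [← hL]
    exact intervalIntegral.integral_mono_interval le_rfl hx.1 hx.2
      (ae_of_all _ fun z => norm_nonneg _) (hwc.intervalIntegrable _ _)
  have hXb : ∀ x ∈ Icc (-1:ℝ) 1, ‖X x‖ ≤ 2 * L := by
    intro x hx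
    have h1 : ‖g x - g (-1)‖ ≤ σ x := by
      rw [← intervalIntegral.integral_eq_sub_of_hasDerivAt (f := g) (f' := deriv g) (a := -1) (b := x)
        (fun y _ => (hg.differentiable (by simp) y).hasDerivAt) ((contDeriv hg).intervalIntegrable _ _)]
      exact intervalIntegral.norm_integral_le_integral_norm hx.1
    have h2 : ‖σ x • (L⁻¹ • d)‖ ≤ σ x := by
      rw [norm_smul, norm_smul, norm_inv, Real.norm_of_nonneg hL0.le,
        Real.norm_of_nonneg (hσle x hx).1]
      exact mul_le_of_le_one_right (hσle x hx).1 hdL'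
    have := norm_sub_le (g x - g (-1)) (σ x • (L⁻¹ • d))
    simp only [hX]
    linarith [(hσle x hx).2]
  have hTc : ContinuousOn (utang g) (Icc (-1:ℝ) 1) := (smooth_utang hg).continuousOn.mono hr
  have hκc : ContinuousOn (curvV g) (Icc (-1:ℝ) 1) := (smooth_curvV hg).continuousOn.mono hr
  have hK1c : ContinuousOn (aderivPIter g 1 (curvV g)) (Icc (-1:ℝ) 1) :=
    (smooth_iter hg 1).continuousOn.mono hr
  have hK2c : ContinuousOn (aderivPIter g 2 (curvV g)) (Icc (-1:ℝ) 1) :=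
    (smooth_iter hg 2).continuousOn.mono hr
  have hVc : ContinuousOn V (Icc (-1:ℝ) 1) := by
    simp only [hV, gradElE]; fun_prop
  have hXc : ContinuousOn X (Icc (-1:ℝ) 1) := fun x hx => (hXd x hx).continuousAt.continuousWithinAt
  have hVX : ContinuousOn (fun x => inner ℝ (V x) (X x)) (Icc (-1:ℝ) 1) := hVc.inner hXc
  have hgd : ContinuousOn (fun x => inner ℝ (deriv g x) d) (Icc (-1:ℝ) 1) :=
    (contDeriv hg).continuousOn.inner continuousOn_const
  have hTd : ContinuousOn (fun x => inner ℝ (utang g x) d) (Icc (-1:ℝ) 1) :=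
    hTc.inner continuousOn_const
  have hKd : ContinuousOn (fun x => inner ℝ (aderivPIter g 1 (curvV g) x) d) (Icc (-1:ℝ) 1) :=
    hK1c.inner continuousOn_const
  set R : ℝ → ℝ := fun x => L⁻¹ * (2 * inner ℝ (aderivPIter g 1 (curvV g) x) d +
        ‖curvV g x‖ ^ 2 * inner ℝ (utang g x) d) * ‖deriv g x‖ with hR
  have hRc : ContinuousOn R (Icc (-1:ℝ) 1) := by
    simp only [hR]; fun_prop
  have hPX : ∀ x ∈ Icc (-1:ℝ) 1, HasDerivAt (fun y => inner ℝ (pvec g l y) (X y))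
      (((‖curvV g x‖ ^ 2 * ‖deriv g x‖ - l * ‖deriv g x‖) + l * L⁻¹ * inner ℝ (deriv g x) d - R x)
        + inner ℝ (V x) (X x) * ‖deriv g x‖) x := by
    intro x hx
    have := (pvec_deriv hg l (hr x hx)).inner ℝ (hXd x hx)
    rw [pvec_inner hg (hr x hx), inner_smul_left] at this
    refine this.congr_deriv ?_
    simp only [hR, hV, conj_trivial]
    ring
  have hid := intervalIntegral.integral_eq_sub_of_hasDerivAt (a := -1) (b := 1)
    (by rw [uIcc_of_le (by norm_num)]; exact hPX) (ii_of_cont (by fun_prop))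
  have hgdint : (∫ x in (-1:ℝ)..1, inner ℝ (deriv g x) d) = ‖d‖ ^ 2 := by
    rw [intervalIntegral.integral_eq_sub_of_hasDerivAt (f := fun x => inner ℝ (g x) d)]
    · rw [← inner_sub_left, ← hdd, real_inner_self_eq_norm_sq]
    · intro y _
      have := ((hg.differentiable (by simp) y).hasDerivAt).inner ℝ (hasDerivAt_const y d)
      simpa using this
    · exact ii_of_cont hgd
  simp only [hX0, hX1, inner_zero_right, sub_zero] at hid
  rw [intervalIntegral.integral_add (ii_of_cont (by fun_prop)) (ii_of_cont (by fun_prop)),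
    intervalIntegral.integral_sub (ii_of_cont (by fun_prop)) (ii_of_cont (by fun_prop)),
    intervalIntegral.integral_add (ii_of_cont (by fun_prop)) (ii_of_cont (by fun_prop)),
    intervalIntegral.integral_sub (ii_of_cont (by fun_prop)) (ii_of_cont (by fun_prop)),
    intervalIntegral.integral_const_mul, intervalIntegral.integral_const_mul, hgdint] at hid
  change elE g - l * elL g + l * L⁻¹ * ‖d‖ ^ 2 - (∫ x in (-1:ℝ)..1, R x) + _ = 0 at hid
  rw [hL] at hid
  have hb1 : |∫ x in (-1:ℝ)..1, inner ℝ (V x) (X x) * ‖deriv g x‖| ≤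
      Real.sqrt ((2 * L) ^ 2 * L) * l2ds g V := by
    have h1 : |∫ x in (-1:ℝ)..1, inner ℝ (V x) (X x) * ‖deriv g x‖| ≤
        ∫ x in (-1:ℝ)..1, |inner ℝ (V x) (X x) * ‖deriv g x‖| :=
      intervalIntegral.abs_integral_le_integral_abs (by norm_num)
    have h2 : (∫ x in (-1:ℝ)..1, |inner ℝ (V x) (X x) * ‖deriv g x‖|) ≤
        ∫ x in (-1:ℝ)..1, (2 * L) * ‖V x‖ * ‖deriv g x‖ := by
      apply intervalIntegral.integral_mono_on (by norm_num)
      · exact ii_of_cont (by fun_prop)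
      · exact ii_of_cont (by fun_prop)
      · intro x hx
        rw [abs_mul, abs_norm]
        apply mul_le_mul_of_nonneg_right _ (norm_nonneg _)
        have := abs_real_inner_le_norm (V x) (X x)
        nlinarith [hXb x hx, norm_nonneg (V x)]
    have h3 := wcs (u := fun _ => 2 * L) (v := fun x => ‖V x‖) continuousOn_const hVc.norm hwco
      (fun _ _ => norm_nonneg _)
    rw [intervalIntegral.integral_const_mul] at h3
    change _ ≤ Real.sqrt ((2 * L) ^ 2 * elL g) * l2ds g V at h3
    rw [hL] at h3
    linarith
  have hb2 : |∫ x in (-1:ℝ)..1, R x| ≤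
      2 * Real.sqrt L * l2ds g (aderivPIter g 1 (curvV g)) + elE g := by
    have h1 : |∫ x in (-1:ℝ)..1, R x| ≤ ∫ x in (-1:ℝ)..1, |R x| :=
      intervalIntegral.abs_integral_le_integral_abs (by norm_num)
    have h2 : (∫ x in (-1:ℝ)..1, |R x|) ≤
        ∫ x in (-1:ℝ)..1, (2 * (1 * ‖aderivPIter g 1 (curvV g) x‖ * ‖deriv g x‖) +
          ‖curvV g x‖ ^ 2 * ‖deriv g x‖) := by
      apply intervalIntegral.integral_mono_on (by norm_num)
      · exact ii_of_cont (by fun_prop)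
      · exact ii_of_cont (by fun_prop)
      · intro x hx
        simp only [hR]
        rw [abs_mul, abs_norm, abs_mul, abs_of_pos (inv_pos.2 hL0)]
        have e : 2 * (1 * ‖aderivPIter g 1 (curvV g) x‖ * ‖deriv g x‖) +
          ‖curvV g x‖ ^ 2 * ‖deriv g x‖ = (2 * ‖aderivPIter g 1 (curvV g) x‖ + ‖curvV g x‖ ^ 2)
            * ‖deriv g x‖ := by ring
        rw [e]
        apply mul_le_mul_of_nonneg_right _ (norm_nonneg _)
        have k1 := abs_real_inner_le_norm (aderivPIter g 1 (curvV g) x) d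
        have k2 := abs_real_inner_le_norm (utang g x) d
        have k3 : ‖utang g x‖ = 1 := by
          have := utang_unit (g := g) (hr x hx)
          rw [real_inner_self_eq_norm_sq] at this
          nlinarith [norm_nonneg (utang g x)]
        rw [k3, one_mul] at k2
        have k4 := abs_add_le (2 * inner ℝ (aderivPIter g 1 (curvV g) x) d)
          (‖curvV g x‖ ^ 2 * inner ℝ (utang g x) d)
        rw [abs_mul, abs_mul, abs_two, abs_of_nonneg (sq_nonneg ‖curvV g x‖)] at k4
        have k5 := mul_le_mul_of_nonneg_left k2 (sq_nonneg ‖curvV g x‖)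
        have k6 : |2 * inner ℝ (aderivPIter g 1 (curvV g) x) d + ‖curvV g x‖ ^ 2 * inner ℝ (utang g x) d|
          ≤ (2 * ‖aderivPIter g 1 (curvV g) x‖ + ‖curvV g x‖ ^ 2) * ‖d‖ := by linarith
        calc _ ≤ L⁻¹ * ((2 * ‖aderivPIter g 1 (curvV g) x‖ + ‖curvV g x‖ ^ 2) * ‖d‖) :=
              mul_le_mul_of_nonneg_left k6 (inv_pos.2 hL0).le
          _ = (2 * ‖aderivPIter g 1 (curvV g) x‖ + ‖curvV g x‖ ^ 2) * (L⁻¹ * ‖d‖) := by ring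
          _ ≤ _ := mul_le_of_le_one_right (by positivity) hdL'
    rw [intervalIntegral.integral_add (ii_of_cont (by fun_prop)) (ii_of_cont (by fun_prop)),
      intervalIntegral.integral_const_mul] at h2
    have h3 := wcs (u := fun _ => 1) (v := fun x => ‖aderivPIter g 1 (curvV g) x‖)
      continuousOn_const hK1c.norm hwco (fun _ _ => norm_nonneg _)
    rw [intervalIntegral.integral_const_mul] at h3
    change _ ≤ Real.sqrt (1 ^ 2 * elL g) * l2ds g (aderivPIter g 1 (curvV g)) at h3
    rw [hL, one_pow, one_mul] at h3
    change _ ≤ _ + elE g at h2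
    linarith
  have hE0 : 0 ≤ elE g := int_nonneg fun x _ => by positivity
  have hfac : ζ ≤ L - L⁻¹ * ‖d‖ ^ 2 := by
    have : L⁻¹ * ‖d‖ ^ 2 ≤ ‖d‖ := by
      calc _ = (L⁻¹ * ‖d‖) * ‖d‖ := by ring
        _ ≤ _ := mul_le_of_le_one_left (norm_nonneg _) hdL'
    linarith
  have heq : l * (L - L⁻¹ * ‖d‖ ^ 2) = elE g - (∫ x in (-1:ℝ)..1, R x) +
      ∫ x in (-1:ℝ)..1, inner ℝ (V x) (X x) * ‖deriv g x‖ := by linarith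
  have habs : |l| * (L - L⁻¹ * ‖d‖ ^ 2) = |l * (L - L⁻¹ * ‖d‖ ^ 2)| := by
    rw [abs_mul, abs_of_pos (a := L - L⁻¹ * ‖d‖ ^ 2) (by linarith)]
  calc |l| * ζ ≤ |l| * (L - L⁻¹ * ‖d‖ ^ 2) := mul_le_mul_of_nonneg_left hfac (abs_nonneg _)
    _ = _ := habs
    _ ≤ _ := by
      rw [heq, abs_le]
      have := abs_le.1 hb1
      have := abs_le.1 hb2
      constructor <;> linarith

end mainest

/-- refined a priori estimate for the Lagrange multiplier (Lemma 4.5). -/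
theorem statement10
    (n m : ℕ) (hn : 2 ≤ n) (L₀ E₀ ζ : ℝ) (hL : 0 < L₀) (hE : 0 < E₀) (hζ : 0 < ζ) :
    ∃ C : ℝ, 0 < C ∧
      ∀ γ : ℝ → EuclideanSpace ℝ (Fin n),
        ContDiff ℝ (⊤ : ℕ∞) γ →
        (∀ x ∈ Icc (-1:ℝ) 1, deriv γ x ≠ 0) →
        elL γ = L₀ → 0 < elE γ → elE γ ≤ E₀ →
        ζ ≤ L₀ - ‖γ 1 - γ (-1)‖ →
        |lagMul γ|
          ≤ C * (1 + l2ds γ (fun x => gradElE γ x - lagMul γ • curvV γ x)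
              + l2ds γ (aderivPIter γ (m + 2) (curvV γ)) ^ ((1:ℝ) / (m + 2))) := by
  obtain ⟨Q, hQ, HQ⟩ := l2_interp (n := n) hL
  obtain ⟨D, hD, HD⟩ := discrete'' Q hQ (Real.sqrt E₀) (Real.sqrt_nonneg _) m
  set B := Real.sqrt ((2 * L₀) ^ 2 * L₀)
  have hB : 0 ≤ B := Real.sqrt_nonneg _
  have hS : 0 ≤ Real.sqrt L₀ := Real.sqrt_nonneg _
  refine ⟨(B + 2 * E₀ + 2 * Real.sqrt L₀ * D) / ζ, by positivity, ?_⟩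
  intro γ hg hr hLg _ hEle hd
  have h1 := main_est hg hr hL hLg hζ hd (lagMul γ)
  have h2 := HD (fun i => l2ds γ (aderivPIter γ i (curvV γ))) (fun _ => Real.sqrt_nonneg _)
    (Real.sqrt_le_sqrt hEle) (HQ γ hg hr hLg)
  have hv : 0 ≤ l2ds γ (fun x => gradElE γ x - lagMul γ • curvV γ x) := Real.sqrt_nonneg _
  have hp : 0 ≤ l2ds γ (aderivPIter γ (m + 2) (curvV γ)) ^ ((1:ℝ) / (m + 2)) :=
    Real.rpow_nonneg (Real.sqrt_nonneg _) _
  set v := l2ds γ (fun x => gradElE γ x - lagMul γ • curvV γ x)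
  set p := l2ds γ (aderivPIter γ (m + 2) (curvV γ)) ^ ((1:ℝ) / (m + 2))
  rw [div_mul_eq_mul_div, le_div_iff₀ hζ]
  have h3 := mul_le_mul_of_nonneg_left h2 (by positivity : 0 ≤ 2 * Real.sqrt L₀)
  have q1 : 0 ≤ B * (1 + p) := by positivity
  have q2 : 0 ≤ 2 * E₀ * (v + p) := by positivity
  have q3 : 0 ≤ 2 * Real.sqrt L₀ * D * v := by positivity
  calc |lagMul γ| * ζ ≤ B * v + 2 * E₀ + 2 * Real.sqrt L₀ * (D * (1 + p)) := by linarith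
    _ ≤ _ := by nlinarith

end
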